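/- arXiv:1012.4414 — 2 statements merged into one kernel-verified Lean document; each statement's English description precedes it below -/
import Mathlib

section
/- Let k ≥ 1 and n ≥ 2k+1 be integers. For every smooth, compactly supported function u : ℝⁿ → ℝ one has ∫_{ℝⁿ} ‖x‖^{2k−n} (Δ₀ᵏ u)(x) dx = c_{n,k} · u(0). (Equivalently, c_{n,k}⁻¹ ‖x‖^{2k−n} is a fundamental solution of the k-th power of the Laplacian Δ₀ᵏ on ℝⁿ, with singularity at the origin.) -/
open MeasureTheory Real

/-- The geometric Laplacian `Δ₀ f = -∑ ∂²f/∂xᵢ²` on Euclidean space. -/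
noncomputable def lap {n : ℕ} (f : EuclideanSpace ℝ (Fin n) → ℝ) :
    EuclideanSpace ℝ (Fin n) → ℝ :=
  fun x => - ∑ i : Fin n,
    fderiv ℝ (fun y => fderiv ℝ f y (EuclideanSpace.single i 1)) x (EuclideanSpace.single i 1)

/-- The `k`-fold iterate `Δ₀ᵏ` of the geometric Laplacian. -/
noncomputable def lapIter {n : ℕ} (k : ℕ) :
    (EuclideanSpace ℝ (Fin n) → ℝ) → (EuclideanSpace ℝ (Fin n) → ℝ) :=
  lap^[k]

/-- The surface measure of the unit sphere `S^{n-1} ⊂ ℝⁿ`: `2 π^{n/2} / Γ(n/2)`. -/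
noncomputable def sphereVol (n : ℕ) : ℝ :=
  2 * Real.pi ^ ((n : ℝ) / 2) / Real.Gamma ((n : ℝ) / 2)

/-- The constant `c_{n,k} = Vol(S^{n-1}) 2^{k-1} (k-1)! (n-2)(n-4)⋯(n-2k)`. -/
noncomputable def cnk (n k : ℕ) : ℝ :=
  sphereVol n * 2 ^ (k - 1) * (Nat.factorial (k - 1)) *
    ∏ j ∈ Finset.range k, ((n : ℝ) - 2 * (j + 1))


open Filter Topology Set Module

section Laplacian

variable {n : ℕ}

lemma ContDiff.fderiv_apply_const {f : EuclideanSpace ℝ (Fin n) → ℝ}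
    (hf : ContDiff ℝ (⊤ : ℕ∞) f) (e : EuclideanSpace ℝ (Fin n)) :
    ContDiff ℝ (⊤ : ℕ∞) (fun y => fderiv ℝ f y e) :=
  (hf.fderiv_right (m := (⊤ : ℕ∞)) (by simp)).clm_apply contDiff_const

lemma contDiff_lap {f : EuclideanSpace ℝ (Fin n) → ℝ} (hf : ContDiff ℝ (⊤ : ℕ∞) f) :
    ContDiff ℝ (⊤ : ℕ∞) (lap f) :=
  (ContDiff.sum fun _ _ => (hf.fderiv_apply_const _).fderiv_apply_const _).neg

lemma HasCompactSupport.lap {f : EuclideanSpace ℝ (Fin n) → ℝ} (hf : HasCompactSupport f) :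
    HasCompactSupport (lap f) := by
  refine hf.mono' fun x hx => ?_
  by_contra hxs
  refine hx ?_
  have h (e : EuclideanSpace ℝ (Fin n)) :
      fderiv ℝ (fun y => fderiv ℝ f y e) x e = 0 := by
    have hzero : (fun y => fderiv ℝ f y e) =ᶠ[𝓝 x] fun _ => 0 := by
      have := (isClosed_tsupport f).isOpen_compl.mem_nhds hxs
      filter_upwards [this] with y hy
      rw [show fderiv ℝ f y = 0 from by
        by_contra h0
        exact hy (support_fderiv_subset ℝ h0)]
      rfl
    rw [hzero.fderiv_eq]
    simp
  simp [_root_.lap, h]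

lemma contDiff_lapIter (k : ℕ) {f : EuclideanSpace ℝ (Fin n) → ℝ}
    (hf : ContDiff ℝ (⊤ : ℕ∞) f) : ContDiff ℝ (⊤ : ℕ∞) (lapIter k f) := by
  induction k with
  | zero => exact hf
  | succ k ih => rw [lapIter, Function.iterate_succ_apply']; exact contDiff_lap ih

lemma hasCompactSupport_lapIter (k : ℕ) {f : EuclideanSpace ℝ (Fin n) → ℝ}
    (hf : HasCompactSupport f) : HasCompactSupport (lapIter k f) := by
  induction k with
  | zero => exact hf
  | succ k ih => rw [lapIter, Function.iterate_succ_apply']; exact ih.lap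

/-- Integration by parts in a fixed direction, against a compactly supported function. -/
lemma integral_mul_fderiv_eq_neg_fderiv_mul {f g : EuclideanSpace ℝ (Fin n) → ℝ}
    (hf : ContDiff ℝ (⊤ : ℕ∞) f) (hg : ContDiff ℝ (⊤ : ℕ∞) g) (hgs : HasCompactSupport g)
    (e : EuclideanSpace ℝ (Fin n)) :
    ∫ x, f x * fderiv ℝ g x e = - ∫ x, fderiv ℝ f x e * g x := by
  have hg' := (hg.fderiv_apply_const e).continuous
  have hf' := (hf.fderiv_apply_const e).continuous
  refine integral_mul_fderiv_eq_neg_fderiv_mul_of_integrable ?_ ?_ ?_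
    (fun x _ => hf.differentiable (by simp) x) (fun x _ => hg.differentiable (by simp) x)
  · exact (hf'.mul hg.continuous).integrable_of_hasCompactSupport hgs.mul_left
  · exact (hf.continuous.mul hg').integrable_of_hasCompactSupport
      (hgs.fderiv_apply ℝ e).mul_left
  · exact (hf.continuous.mul hg.continuous).integrable_of_hasCompactSupport hgs.mul_left

/-- **Green's second identity** on `ℝⁿ`, against a compactly supported function. -/
lemma integral_mul_lap_eq_integral_lap_mul {f g : EuclideanSpace ℝ (Fin n) → ℝ}
    (hf : ContDiff ℝ (⊤ : ℕ∞) f) (hg : ContDiff ℝ (⊤ : ℕ∞) g) (hgs : HasCompactSupport g) :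
    ∫ x, f x * lap g x = ∫ x, lap f x * g x := by
  simp only [lap, mul_neg, neg_mul, integral_neg, Finset.mul_sum, Finset.sum_mul]
  congr 1
  rw [integral_finsetSum, integral_finsetSum]
  · refine Finset.sum_congr rfl fun i _ => ?_
    set e := EuclideanSpace.single i (1 : ℝ)
    rw [integral_mul_fderiv_eq_neg_fderiv_mul hf (hg.fderiv_apply_const e)
      (hgs.fderiv_apply ℝ e), integral_mul_fderiv_eq_neg_fderiv_mul
      (hf.fderiv_apply_const e) hg hgs, neg_neg]
  · intro i _
    exact (((hf.fderiv_apply_const _).fderiv_apply_const _).continuous.mul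
      hg.continuous).integrable_of_hasCompactSupport hgs.mul_left
  · intro i _
    exact (hf.continuous.mul ((hg.fderiv_apply_const _).fderiv_apply_const
      _).continuous).integrable_of_hasCompactSupport
      ((hgs.fderiv_apply ℝ _).fderiv_apply ℝ _).mul_left

end Laplacian

section RegularizedPower

variable {n : ℕ}

lemma contDiff_normSq_add_rpow {a : ℝ} (ha : 0 < a) (p : ℝ) :
    ContDiff ℝ (⊤ : ℕ∞) (fun x : EuclideanSpace ℝ (Fin n) => (‖x‖ ^ 2 + a) ^ p) :=
  ((contDiff_norm_sq ℝ).add contDiff_const).rpow_const_of_ne fun x => by positivity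

lemma hasFDerivAt_normSq_add_rpow {a : ℝ} (ha : 0 < a) (p : ℝ)
    (x : EuclideanSpace ℝ (Fin n)) :
    HasFDerivAt (fun x : EuclideanSpace ℝ (Fin n) => (‖x‖ ^ 2 + a) ^ p)
      ((p * (‖x‖ ^ 2 + a) ^ (p - 1)) • (2 • innerSL ℝ x)) x :=
  ((hasStrictFDerivAt_norm_sq x).hasFDerivAt.add_const a).rpow_const
    (Or.inl (by positivity))

lemma fderiv_normSq_add_rpow_single {a : ℝ} (ha : 0 < a) (p : ℝ)
    (x : EuclideanSpace ℝ (Fin n)) (i : Fin n) :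
    fderiv ℝ (fun x : EuclideanSpace ℝ (Fin n) => (‖x‖ ^ 2 + a) ^ p) x
      (EuclideanSpace.single i 1) = 2 * p * (x i * (‖x‖ ^ 2 + a) ^ (p - 1)) := by
  rw [(hasFDerivAt_normSq_add_rpow ha p x).fderiv]
  simp [EuclideanSpace.inner_single_right]
  ring

lemma lap_normSq_add_rpow {a : ℝ} (ha : 0 < a) (p : ℝ) (x : EuclideanSpace ℝ (Fin n)) :
    lap (fun x : EuclideanSpace ℝ (Fin n) => (‖x‖ ^ 2 + a) ^ p) x =
      -(2 * p * (n + 2 * p - 2)) * (‖x‖ ^ 2 + a) ^ (p - 1) +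
        4 * p * (p - 1) * (a * (‖x‖ ^ 2 + a) ^ (p - 1 - 1)) := by
  have hpos : 0 < ‖x‖ ^ 2 + a := by positivity
  have hi (i : Fin n) : fderiv ℝ (fun y => fderiv ℝ
      (fun x : EuclideanSpace ℝ (Fin n) => (‖x‖ ^ 2 + a) ^ p) y (EuclideanSpace.single i 1)) x
      (EuclideanSpace.single i 1) = 2 * p * (‖x‖ ^ 2 + a) ^ (p - 1) +
        4 * p * (p - 1) * (‖x‖ ^ 2 + a) ^ (p - 1 - 1) * x i ^ 2 := by
    simp_rw [fderiv_normSq_add_rpow_single ha p]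
    have hcoord : HasFDerivAt (fun y : EuclideanSpace ℝ (Fin n) => y i)
        (EuclideanSpace.proj i : EuclideanSpace ℝ (Fin n) →L[ℝ] ℝ) x :=
      (EuclideanSpace.proj i : EuclideanSpace ℝ (Fin n) →L[ℝ] ℝ).hasFDerivAt
    have h : HasFDerivAt (fun y : EuclideanSpace ℝ (Fin n) =>
        2 * p * (y i * (‖y‖ ^ 2 + a) ^ (p - 1))) _ x :=
      (hcoord.mul (hasFDerivAt_normSq_add_rpow ha (p - 1) x)).const_mul (2 * p)
    rw [h.fderiv]
    simp [EuclideanSpace.inner_single_right]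
    ring
  have hsplit : (‖x‖ ^ 2 + a) ^ (p - 1) =
      (‖x‖ ^ 2 + a) ^ (p - 1 - 1) * (‖x‖ ^ 2 + a) := by
    rw [← rpow_add_one hpos.ne']
    ring_nf
  simp only [lap, hi]
  rw [Finset.sum_add_distrib, ← Finset.mul_sum Finset.univ (fun i => x i ^ 2), ← EuclideanSpace.real_norm_sq_eq]
  simp only [Finset.sum_const, Finset.card_univ, Fintype.card_fin, nsmul_eq_mul]
  rw [hsplit]
  ring

lemma integral_normSq_add_rpow_mul_lap {a : ℝ} (ha : 0 < a) (p : ℝ)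
    {v : EuclideanSpace ℝ (Fin n) → ℝ} (hv : ContDiff ℝ (⊤ : ℕ∞) v)
    (hvs : HasCompactSupport v) :
    ∫ x, (‖x‖ ^ 2 + a) ^ p * lap v x =
      -(2 * p * (n + 2 * p - 2)) * (∫ x, (‖x‖ ^ 2 + a) ^ (p - 1) * v x) +
        4 * p * (p - 1) * ∫ x, a * (‖x‖ ^ 2 + a) ^ (p - 1 - 1) * v x := by
  have hint (q : ℝ) : Integrable (fun x => (‖x‖ ^ 2 + a) ^ q * v x) :=
    ((contDiff_normSq_add_rpow ha q).continuous.mul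
      hv.continuous).integrable_of_hasCompactSupport hvs.mul_left
  rw [integral_mul_lap_eq_integral_lap_mul (contDiff_normSq_add_rpow ha p) hv hvs]
  simp only [lap_normSq_add_rpow ha p, add_mul, mul_assoc]
  rw [integral_add]
  · simp only [integral_const_mul]
  · exact (hint _).const_mul _
  · exact ((((hint _).const_mul _).const_mul _).const_mul _).const_mul _

end RegularizedPower

section Limits

variable {n : ℕ}

lemma integrable_norm_rpow_mul (hn : n ≠ 0) {s : ℝ} (hs : -(n : ℝ) < s)
    {v : EuclideanSpace ℝ (Fin n) → ℝ} (hv : Continuous v) (hvs : HasCompactSupport v) :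
    Integrable (fun x => ‖x‖ ^ s * v x) := by
  have : NeZero n := ⟨hn⟩
  obtain ⟨C, hC⟩ := hv.bounded_above_of_compact_support hvs
  obtain ⟨R, hR⟩ := hvs.isCompact.isBounded.subset_ball 0
  have hball : IntegrableOn (fun x : EuclideanSpace ℝ (Fin n) => ‖x‖ ^ s)
      (Metric.ball 0 (max R 1)) := by
    rw [integrableOn_fun_norm_addHaar volume (f := fun r => r ^ s)]
    have := (intervalIntegral.integrableOn_Ioo_rpow_iff (s := n - 1 + s) (t := max R 1)
      (by positivity)).2 (by linarith)
    refine this.congr_fun (fun y hy => ?_) measurableSet_Ioo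
    simp only [finrank_euclideanSpace, Fintype.card_fin, smul_eq_mul]
    rw [rpow_add hy.1, ← rpow_natCast, Nat.cast_pred (Nat.pos_of_ne_zero hn)]
  have hmul : IntegrableOn (fun x : EuclideanSpace ℝ (Fin n) => ‖x‖ ^ s * v x)
      (Metric.ball 0 (max R 1)) :=
    hball.mul_bdd (c := C) hv.aestronglyMeasurable (ae_of_all _ hC)
  refine (integrableOn_iff_integrable_of_support_subset fun x hx => ?_).1 hmul
  refine Metric.ball_subset_ball (le_max_left _ _) (hR (subset_tsupport v ?_))
  exact right_ne_zero_of_mul hx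

lemma ae_ne_zero (hn : n ≠ 0) : ∀ᵐ x : EuclideanSpace ℝ (Fin n), x ≠ 0 := by
  have : NeZero n := ⟨hn⟩
  exact Measure.ae_ne volume 0

lemma normSq_rpow {x : EuclideanSpace ℝ (Fin n)} (p : ℝ) :
    (‖x‖ ^ 2) ^ p = ‖x‖ ^ (2 * p) := by
  rw [← rpow_natCast, ← rpow_mul (norm_nonneg x)]
  norm_num

lemma tendsto_integral_normSq_add_rpow_mul (hn : n ≠ 0) {p : ℝ} (hp : p ≤ 0)
    (hpn : -(n : ℝ) < 2 * p) {v : EuclideanSpace ℝ (Fin n) → ℝ} (hv : Continuous v)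
    (hvs : HasCompactSupport v) :
    Tendsto (fun a : ℝ => ∫ x, (‖x‖ ^ 2 + a) ^ p * v x) (𝓝[>] 0)
      (𝓝 (∫ x, ‖x‖ ^ (2 * p) * v x)) := by
  refine tendsto_integral_filter_of_dominated_convergence (fun x => ‖‖x‖ ^ (2 * p) * v x‖)
    ?_ ?_ (integrable_norm_rpow_mul hn hpn hv hvs).norm ?_
  · filter_upwards [self_mem_nhdsWithin] with a ha
    exact ((contDiff_normSq_add_rpow ha p).continuous.mul hv).aestronglyMeasurable
  · filter_upwards [self_mem_nhdsWithin] with a (ha : 0 < a)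
    filter_upwards [ae_ne_zero hn] with x hx
    rw [norm_mul, norm_mul, ← normSq_rpow]
    gcongr
    rw [norm_of_nonneg (by positivity), norm_of_nonneg (by positivity)]
    exact rpow_le_rpow_of_nonpos (by positivity) (by linarith) hp
  · filter_upwards [ae_ne_zero hn] with x hx
    rw [← normSq_rpow]
    refine Tendsto.mul_const _ (tendsto_nhdsWithin_of_tendsto_nhds ?_)
    have : ContinuousAt (fun a : ℝ => (‖x‖ ^ 2 + a) ^ p) 0 :=
      (by fun_prop : ContinuousAt (fun a : ℝ => ‖x‖ ^ 2 + a) 0).rpow_const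
        (Or.inl (by positivity))
    simpa [ContinuousAt] using this

lemma tendsto_integral_mul_normSq_add_rpow_mul (hn : n ≠ 0) {p : ℝ} (hp : p ≤ 0)
    (hpn : -(n : ℝ) < 2 * p) {v : EuclideanSpace ℝ (Fin n) → ℝ} (hv : Continuous v)
    (hvs : HasCompactSupport v) :
    Tendsto (fun a : ℝ => ∫ x, a * (‖x‖ ^ 2 + a) ^ (p - 1) * v x) (𝓝[>] 0) (𝓝 0) := by
  suffices h : Tendsto (fun a : ℝ => ∫ x, a * (‖x‖ ^ 2 + a) ^ (p - 1) * v x) (𝓝[>] 0)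
      (𝓝 (∫ _ : EuclideanSpace ℝ (Fin n), (0 : ℝ))) by
    simpa only [integral_zero] using h
  refine tendsto_integral_filter_of_dominated_convergence (fun x => ‖‖x‖ ^ (2 * p) * v x‖)
    ?_ ?_ (integrable_norm_rpow_mul hn hpn hv hvs).norm ?_
  · filter_upwards [self_mem_nhdsWithin] with a ha
    exact (((contDiff_normSq_add_rpow ha _).continuous.const_mul a).mul hv).aestronglyMeasurable
  · filter_upwards [self_mem_nhdsWithin] with a (ha : 0 < a)
    filter_upwards [ae_ne_zero hn] with x hx
    have hpos : 0 < ‖x‖ ^ 2 + a := by positivity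
    rw [norm_mul _ (v x), norm_mul _ (v x), ← normSq_rpow]
    gcongr
    rw [norm_of_nonneg (by positivity), norm_of_nonneg (by positivity)]
    calc a * (‖x‖ ^ 2 + a) ^ (p - 1) ≤ (‖x‖ ^ 2 + a) * (‖x‖ ^ 2 + a) ^ (p - 1) := by
          gcongr
          linarith [sq_nonneg ‖x‖]
      _ = (‖x‖ ^ 2 + a) ^ p := by
          rw [rpow_sub_one hpos.ne']
          field_simp
      _ ≤ (‖x‖ ^ 2) ^ p :=
          rpow_le_rpow_of_nonpos (by positivity) (by linarith) hp
  · filter_upwards [ae_ne_zero hn] with x hx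
    refine tendsto_nhdsWithin_of_tendsto_nhds ?_
    have : ContinuousAt (fun a : ℝ => a * (‖x‖ ^ 2 + a) ^ (p - 1) * v x) 0 :=
      (continuousAt_id.mul ((by fun_prop : ContinuousAt (fun a : ℝ => ‖x‖ ^ 2 + a) 0).rpow_const
        (Or.inl (by positivity)))).mul_const _
    simpa [ContinuousAt] using this

/-- The recursion `Δ₀ ‖x‖^(2p) = -2p (n + 2p - 2) ‖x‖^(2(p-1))` in the sense of distributions. -/
lemma integral_norm_rpow_mul_lap (hn : n ≠ 0) {p : ℝ} (hp : p ≤ 0)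
    (hpn : -(n : ℝ) < 2 * (p - 1)) {v : EuclideanSpace ℝ (Fin n) → ℝ}
    (hv : ContDiff ℝ (⊤ : ℕ∞) v) (hvs : HasCompactSupport v) :
    ∫ x, ‖x‖ ^ (2 * p) * lap v x =
      -(2 * p * (n + 2 * p - 2)) * ∫ x, ‖x‖ ^ (2 * (p - 1)) * v x := by
  have h₁ := tendsto_integral_normSq_add_rpow_mul hn hp (by linarith)
    (contDiff_lap hv).continuous hvs.lap
  have h₂ := ((tendsto_integral_normSq_add_rpow_mul hn (by linarith) hpn hv.continuous
    hvs).const_mul (-(2 * p * (n + 2 * p - 2)))).add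
    ((tendsto_integral_mul_normSq_add_rpow_mul hn (by linarith) hpn hv.continuous
    hvs).const_mul (4 * p * (p - 1)))
  rw [mul_zero, add_zero] at h₂
  refine tendsto_nhds_unique h₁ (h₂.congr' ?_)
  filter_upwards [self_mem_nhdsWithin] with a ha
  rw [integral_normSq_add_rpow_mul_lap ha p hv hvs]

end Limits

section Newtonian

variable {n : ℕ}

lemma integrable_one_add_normSq_rpow :
    Integrable (fun x : EuclideanSpace ℝ (Fin n) => (‖x‖ ^ 2 + 1) ^ (-(n : ℝ) / 2 - 1)) := by
  have h := integrable_rpow_neg_one_add_norm_sq (E := EuclideanSpace ℝ (Fin n))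
    (μ := volume) (r := n + 2) (by simp)
  convert! h using 3 with x
  · ring
  · ring

lemma integral_Ioi_pow_mul_sq_add_one_rpow (hn : n ≠ 0)
    (hint : IntegrableOn (fun y : ℝ => y ^ (n - 1) * (y ^ 2 + 1) ^ (-(n : ℝ) / 2 - 1)) (Ioi 0)) :
    ∫ y in Ioi (0 : ℝ), y ^ (n - 1) * (y ^ 2 + 1) ^ (-(n : ℝ) / 2 - 1) = 1 / (n : ℝ) := by
  have hn' : (n : ℝ) ≠ 0 := Nat.cast_ne_zero.2 hn
  have hderiv (y : ℝ) : HasDerivAt (fun y : ℝ => y ^ n * (y ^ 2 + 1) ^ (-(n : ℝ) / 2) / n)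
      (y ^ (n - 1) * (y ^ 2 + 1) ^ (-(n : ℝ) / 2 - 1)) y := by
    have hpos : 0 < y ^ 2 + 1 := by positivity
    have h := (((hasDerivAt_pow n y).mul (((hasDerivAt_pow 2 y).add_const 1).rpow_const
      (p := -(n : ℝ) / 2) (Or.inl hpos.ne'))).div_const (n : ℝ))
    refine h.congr_deriv ?_
    obtain ⟨m, rfl⟩ := Nat.exists_eq_succ_of_ne_zero hn
    rw [rpow_sub_one hpos.ne']
    simp only [Nat.succ_eq_add_one, Nat.add_sub_cancel] at *
    field_simp
    ring
  have hlim : Tendsto (fun y : ℝ => y ^ n * (y ^ 2 + 1) ^ (-(n : ℝ) / 2) / n) atTop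
      (𝓝 (1 / (n : ℝ))) := by
    refine Tendsto.div_const ?_ _
    have h₁ : Tendsto (fun y : ℝ => (1 + (y ^ 2)⁻¹) ^ (-(n : ℝ) / 2)) atTop (𝓝 1) := by
      have h₀ : Tendsto (fun y : ℝ => 1 + (y ^ 2)⁻¹) atTop (𝓝 1) := by
        simpa using (tendsto_inv_atTop_zero.comp
          (tendsto_pow_atTop (α := ℝ) two_ne_zero)).const_add 1
      simpa using h₀.rpow_const (p := -(n : ℝ) / 2) (Or.inl one_ne_zero)
    refine h₁.congr' ?_
    filter_upwards [eventually_gt_atTop 0] with y hy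
    rw [show y ^ 2 + 1 = y ^ 2 * (1 + (y ^ 2)⁻¹) by field_simp, mul_rpow (by positivity)
      (by positivity), ← rpow_natCast y 2, ← rpow_mul hy.le, ← mul_assoc, ← rpow_natCast y n,
      ← rpow_add hy]
    norm_num
    ring_nf
    norm_num
  rw [integral_Ioi_of_hasDerivAt_of_tendsto' (fun y _ => hderiv y) hint hlim]
  simp [hn]

lemma integral_one_add_normSq_rpow (hn : n ≠ 0) :
    ∫ x : EuclideanSpace ℝ (Fin n), (‖x‖ ^ 2 + 1) ^ (-(n : ℝ) / 2 - 1) = sphereVol n / n := by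
  have : NeZero n := ⟨hn⟩
  have hn' : (n : ℝ) ≠ 0 := Nat.cast_ne_zero.2 hn
  have hint := (integrable_fun_norm_addHaar volume
    (f := fun r : ℝ => (r ^ 2 + 1) ^ (-(n : ℝ) / 2 - 1))).1 (integrable_one_add_normSq_rpow (n := n))
  have hvol : volume.real (Metric.ball (0 : EuclideanSpace ℝ (Fin n)) 1) = sphereVol n / n := by
    rw [Measure.real, EuclideanSpace.volume_ball, sphereVol, Fintype.card_fin,
      ENNReal.ofReal_one, one_pow, one_mul, ENNReal.toReal_ofReal (by positivity),
      Gamma_add_one (by positivity), sqrt_eq_rpow, ← rpow_natCast, ← rpow_mul pi_pos.le]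
    field_simp
  rw [integral_fun_norm_addHaar volume (fun r : ℝ => (r ^ 2 + 1) ^ (-(n : ℝ) / 2 - 1)), hvol]
  simp only [finrank_euclideanSpace, Fintype.card_fin, smul_eq_mul, nsmul_eq_mul] at hint ⊢
  rw [integral_Ioi_pow_mul_sq_add_one_rpow hn hint]
  field_simp

lemma integral_sq_mul_normSq_add_sq_rpow_mul {c : ℝ} (hc : 0 < c)
    (v : EuclideanSpace ℝ (Fin n) → ℝ) :
    ∫ x, c ^ 2 * (‖x‖ ^ 2 + c ^ 2) ^ (-(n : ℝ) / 2 - 1) * v x =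
      ∫ x, (‖x‖ ^ 2 + 1) ^ (-(n : ℝ) / 2 - 1) * v (c • x) := by
  have h := Measure.integral_comp_smul volume
    (fun x : EuclideanSpace ℝ (Fin n) =>
      c ^ 2 * (‖x‖ ^ 2 + c ^ 2) ^ (-(n : ℝ) / 2 - 1) * v x) c
  rw [finrank_euclideanSpace, Fintype.card_fin, abs_of_pos (by positivity), smul_eq_mul,
    ← div_eq_inv_mul, eq_div_iff (by positivity), mul_comm, ← integral_const_mul] at h
  rw [← h]
  congr 1
  ext x
  have hpow : (c ^ 2) ^ (-(n : ℝ) / 2 - 1) = (c ^ n * c ^ 2)⁻¹ := by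
    rw [← pow_add, ← rpow_natCast, ← rpow_mul hc.le, ← rpow_natCast, ← rpow_neg hc.le]
    congr 1
    push_cast
    ring
  rw [norm_smul, norm_of_nonneg hc.le,
    show (c * ‖x‖) ^ 2 + c ^ 2 = c ^ 2 * (‖x‖ ^ 2 + 1) by ring,
    mul_rpow (by positivity) (by positivity), hpow]
  field_simp

/-- The kernels `c² (‖x‖² + c²)^(-n/2-1)` concentrate at the origin as `c → 0`. -/
lemma tendsto_integral_approximate_identity (hn : n ≠ 0)
    {v : EuclideanSpace ℝ (Fin n) → ℝ} (hv : Continuous v) (hvs : HasCompactSupport v) :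
    Tendsto (fun c : ℝ => ∫ x, c ^ 2 * (‖x‖ ^ 2 + c ^ 2) ^ (-(n : ℝ) / 2 - 1) * v x) (𝓝[>] 0)
      (𝓝 (sphereVol n / n * v 0)) := by
  obtain ⟨C, hC⟩ := hv.bounded_above_of_compact_support hvs
  rw [← integral_one_add_normSq_rpow hn, ← integral_mul_const]
  have h : Tendsto (fun c : ℝ => ∫ x, (‖x‖ ^ 2 + 1) ^ (-(n : ℝ) / 2 - 1) * v (c • x)) (𝓝[>] 0)
      (𝓝 (∫ x : EuclideanSpace ℝ (Fin n), (‖x‖ ^ 2 + 1) ^ (-(n : ℝ) / 2 - 1) * v 0)) := by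
    refine tendsto_integral_filter_of_dominated_convergence
      (fun x => (‖x‖ ^ 2 + 1) ^ (-(n : ℝ) / 2 - 1) * C) ?_ ?_
      (integrable_one_add_normSq_rpow.mul_const C) ?_
    · refine Eventually.of_forall fun c => ?_
      exact ((contDiff_normSq_add_rpow one_pos _).continuous.mul
        (hv.comp (continuous_const_smul c))).aestronglyMeasurable
    · refine Eventually.of_forall fun c => ae_of_all _ fun x => ?_
      rw [norm_mul, norm_of_nonneg (by positivity)]
      gcongr
      exact hC _
    · refine ae_of_all _ fun x => (tendsto_nhdsWithin_of_tendsto_nhds ?_).const_mul _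
      have : Continuous fun c : ℝ => v (c • x) := by fun_prop
      simpa using this.tendsto 0
  refine h.congr' ?_
  filter_upwards [self_mem_nhdsWithin] with c hc
  rw [integral_sq_mul_normSq_add_sq_rpow_mul hc]

/-- `‖x‖^(2-n)` is, up to a constant, the fundamental solution of the Laplacian. -/
lemma integral_norm_rpow_two_sub_mul_lap (hn : 2 ≤ n)
    {v : EuclideanSpace ℝ (Fin n) → ℝ} (hv : ContDiff ℝ (⊤ : ℕ∞) v)
    (hvs : HasCompactSupport v) :
    ∫ x, ‖x‖ ^ (2 - (n : ℝ)) * lap v x = sphereVol n * (n - 2) * v 0 := by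
  have hn0 : n ≠ 0 := by lia
  have hn' : (n : ℝ) ≠ 0 := Nat.cast_ne_zero.2 hn0
  have hn2 : (2 : ℝ) ≤ n := by exact_mod_cast hn
  have hsq : Tendsto (fun c : ℝ => c ^ 2) (𝓝[>] 0) (𝓝[>] 0) := by
    refine tendsto_nhdsWithin_iff.2 ⟨tendsto_nhdsWithin_of_tendsto_nhds ?_, ?_⟩
    · simpa using (continuous_pow (M := ℝ) 2).tendsto 0
    · filter_upwards [self_mem_nhdsWithin] with c (hc : 0 < c)
      exact pow_pos hc 2
  have h₁ := (tendsto_integral_normSq_add_rpow_mul hn0 (p := 1 - n / 2) (by linarith)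
    (by linarith) (contDiff_lap hv).continuous hvs.lap).comp hsq
  have h₂ := (tendsto_integral_approximate_identity hn0 hv.continuous hvs).const_mul
    (n * ((n : ℝ) - 2))
  rw [show 2 - (n : ℝ) = 2 * (1 - n / 2) by ring]
  refine (tendsto_nhds_unique h₁ (h₂.congr' ?_)).trans (by field_simp)
  filter_upwards [self_mem_nhdsWithin] with c (hc : 0 < c)
  rw [Function.comp_apply, integral_normSq_add_rpow_mul_lap (by positivity) _ hv hvs,
    show (1 - (n : ℝ) / 2 - 1 - 1) = -(n : ℝ) / 2 - 1 by ring]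
  ring

end Newtonian

lemma cnk_one (n : ℕ) : cnk n 1 = sphereVol n * (n - 2) := by
  simp [cnk]

lemma cnk_succ (n : ℕ) {k : ℕ} (hk : 1 ≤ k) :
    cnk n (k + 1) = 2 * k * (n - 2 * (k + 1)) * cnk n k := by
  obtain ⟨m, rfl⟩ := Nat.exists_eq_add_of_le' hk
  simp only [cnk, Nat.add_sub_cancel, Finset.prod_range_succ _ (m + 1), Nat.factorial_succ,
    pow_succ]
  push_cast
  ring

theorem fundamental_solution_of_iterated_laplacian
    (n k : ℕ) (hk : 1 ≤ k) (hn : 2 * k + 1 ≤ n)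
    (u : EuclideanSpace ℝ (Fin n) → ℝ)
    (hu : ContDiff ℝ (⊤ : ℕ∞) u) (hsupp : HasCompactSupport u) :
    ∫ x : EuclideanSpace ℝ (Fin n),
        ‖x‖ ^ (2 * (k : ℝ) - n) * lapIter k u x = cnk n k * u 0 := by
  induction k, hk using Nat.le_induction with
  | base =>
    have h := integral_norm_rpow_two_sub_mul_lap (n := n) (by lia) hu hsupp
    simpa [cnk_one, lapIter] using h
  | succ k hk ih =>
    have hk' : (1 : ℝ) ≤ k := by exact_mod_cast hk
    have hn' : 2 * ((k : ℝ) + 1) + 1 ≤ n := by exact_mod_cast hn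
    have h := integral_norm_rpow_mul_lap (n := n) (by lia) (p := k + 1 - n / 2) (by linarith)
      (by linarith) (contDiff_lapIter k hu) (hasCompactSupport_lapIter k hsupp)
    rw [show 2 * ((k : ℝ) + 1 - n / 2 - 1) = 2 * k - n by ring, ih (by lia)] at h
    rw [cnk_succ n hk, show lapIter (k + 1) u = lap (lapIter k u) from
      Function.iterate_succ_apply' _ _ _,
      show 2 * ((k + 1 : ℕ) : ℝ) - n = 2 * ((k : ℝ) + 1 - n / 2) by push_cast; ring, h]
    ring
end

section
/- Let n ≥ 2 and k ≥ 1 be integers and let α ∈ ℝ be a real number that is not an integer. If u : ℝⁿ∖{0} → ℝ is smooth, positively homogeneous of degree α, and satisfies Δ₀ᵏ u = 0 on ℝⁿ∖{0}, then u is identically zero. -/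
open MeasureTheory Real

open Filter Topology

/-- The partial derivative in the `i`-th coordinate direction. -/
noncomputable def partialDeriv {n : ℕ} (i : Fin n) (f : EuclideanSpace ℝ (Fin n) → ℝ) :
    EuclideanSpace ℝ (Fin n) → ℝ :=
  fun x => fderiv ℝ f x (EuclideanSpace.single i 1)

/-- Functions smooth away from the origin and positively homogeneous of degree `α` there. -/
structure SmoothHomogeneous {n : ℕ} (α : ℝ) (u : EuclideanSpace ℝ (Fin n) → ℝ) : Prop where
  contDiffOn : ContDiffOn ℝ (⊤ : ℕ∞) u {(0 : EuclideanSpace ℝ (Fin n))}ᶜ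
  map_smul : ∀ t : ℝ, 0 < t → ∀ x : EuclideanSpace ℝ (Fin n), x ≠ 0 → u (t • x) = t ^ α * u x

lemma lap_eq_neg_sum_partialDeriv {n : ℕ} (f : EuclideanSpace ℝ (Fin n) → ℝ)
    (x : EuclideanSpace ℝ (Fin n)) :
    lap f x = -∑ i, partialDeriv i (partialDeriv i f) x := rfl

lemma fderiv_eq_sum_partialDeriv {n : ℕ} (f : EuclideanSpace ℝ (Fin n) → ℝ)
    (x v : EuclideanSpace ℝ (Fin n)) :
    fderiv ℝ f x v = ∑ i, v i * partialDeriv i f x := by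
  have hv : v = ∑ i, v i • EuclideanSpace.single i (1 : ℝ) := by
    ext j
    simp [Finset.sum_apply, Pi.single_apply]
  conv_lhs => rw [hv]
  simp [map_sum, partialDeriv]

lemma partialDeriv_congr {n : ℕ} (i : Fin n) {f g : EuclideanSpace ℝ (Fin n) → ℝ}
    (h : ∀ x, x ≠ 0 → f x = g x) (x : EuclideanSpace ℝ (Fin n)) (hx : x ≠ 0) :
    partialDeriv i f x = partialDeriv i g x := by
  have : f =ᶠ[𝓝 x] g := by
    filter_upwards [isOpen_compl_singleton.mem_nhds hx] with y hy using h y hy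
  simp only [partialDeriv, this.fderiv_eq]

lemma partialDeriv_mul {n : ℕ} (i : Fin n) {f g : EuclideanSpace ℝ (Fin n) → ℝ}
    {x : EuclideanSpace ℝ (Fin n)} (hf : DifferentiableAt ℝ f x) (hg : DifferentiableAt ℝ g x) :
    partialDeriv i (fun y => f y * g y) x
      = partialDeriv i f x * g x + f x * partialDeriv i g x := by
  simp only [partialDeriv, fderiv_fun_mul hf hg]
  simp
  ring

lemma partialDeriv_add {n : ℕ} (i : Fin n) {f g : EuclideanSpace ℝ (Fin n) → ℝ}
    {x : EuclideanSpace ℝ (Fin n)} (hf : DifferentiableAt ℝ f x) (hg : DifferentiableAt ℝ g x) :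
    partialDeriv i (fun y => f y + g y) x = partialDeriv i f x + partialDeriv i g x := by
  simp only [partialDeriv, fderiv_fun_add hf hg, add_apply]

lemma partialDeriv_coord {n : ℕ} (i : Fin n) (x : EuclideanSpace ℝ (Fin n)) :
    partialDeriv i (fun y => y i) x = 1 := by
  have : HasFDerivAt (fun y : EuclideanSpace ℝ (Fin n) => y i)
      (EuclideanSpace.proj i : EuclideanSpace ℝ (Fin n) →L[ℝ] ℝ) x :=
    (EuclideanSpace.proj i : EuclideanSpace ℝ (Fin n) →L[ℝ] ℝ).hasFDerivAt
  simp [partialDeriv, this.fderiv]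

lemma partialDeriv_norm_rpow {n : ℕ} (i : Fin n) (s : ℝ) (x : EuclideanSpace ℝ (Fin n))
    (hx : x ≠ 0) :
    partialDeriv i (fun y => ‖y‖ ^ s) x = s * x i * ‖x‖ ^ (s - 2) := by
  have hpos : 0 < ‖x‖ := norm_pos_iff.2 hx
  have h1 : HasFDerivAt (fun y : EuclideanSpace ℝ (Fin n) => ‖y‖ ^ 2) (2 • innerSL ℝ x) x :=
    (hasStrictFDerivAt_norm_sq x).hasFDerivAt
  have h2 := h1.rpow_const (p := s / 2) (Or.inl (by positivity))
  have h3 : (fun y : EuclideanSpace ℝ (Fin n) => (‖y‖ ^ 2) ^ (s / 2)) = fun y => ‖y‖ ^ s := by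
    ext y
    rw [← Real.rpow_natCast, ← Real.rpow_mul (norm_nonneg y)]
    congr 1
    push_cast
    ring
  rw [h3] at h2
  have h4 : (‖x‖ ^ 2) ^ (s / 2 - 1) = ‖x‖ ^ (s - 2) := by
    rw [← Real.rpow_natCast, ← Real.rpow_mul (norm_nonneg x)]
    congr 1
    push_cast
    ring
  simp only [partialDeriv, h2.fderiv, h4]
  simp [EuclideanSpace.inner_single_right]
  ring

lemma contDiffOn_partialDeriv {n : ℕ} (i : Fin n) {u : EuclideanSpace ℝ (Fin n) → ℝ}
    (hu : ContDiffOn ℝ (⊤ : ℕ∞) u {(0 : EuclideanSpace ℝ (Fin n))}ᶜ) :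
    ContDiffOn ℝ (⊤ : ℕ∞) (partialDeriv i u) {(0 : EuclideanSpace ℝ (Fin n))}ᶜ := by
  have := hu.fderiv_of_isOpen (m := (⊤ : ℕ∞)) isOpen_compl_singleton (by simp)
  exact this.clm_apply contDiffOn_const

lemma contDiffOn_norm_rpow {n : ℕ} (s : ℝ) :
    ContDiffOn ℝ (⊤ : ℕ∞) (fun x : EuclideanSpace ℝ (Fin n) => ‖x‖ ^ s) {0}ᶜ :=
  (contDiffOn_id.norm ℝ fun _ hx => hx).rpow_const_of_ne fun _ hx => norm_ne_zero_iff.2 hx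

namespace SmoothHomogeneous

variable {n : ℕ} {α : ℝ} {u : EuclideanSpace ℝ (Fin n) → ℝ}

protected lemma contDiffAt (hu : SmoothHomogeneous α u) {x : EuclideanSpace ℝ (Fin n)} (hx : x ≠ 0) :
    ContDiffAt ℝ (⊤ : ℕ∞) u x :=
  hu.contDiffOn.contDiffAt (isOpen_compl_singleton.mem_nhds hx)

protected lemma differentiableAt (hu : SmoothHomogeneous α u) {x : EuclideanSpace ℝ (Fin n)} (hx : x ≠ 0) :
    DifferentiableAt ℝ u x :=
  (hu.contDiffAt hx).differentiableAt (by simp)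

protected lemma neg (hu : SmoothHomogeneous α u) : SmoothHomogeneous α (fun x => -u x) where
  contDiffOn := hu.contDiffOn.neg
  map_smul t ht x hx := by rw [hu.map_smul t ht x hx]; ring

protected lemma partialDeriv (hu : SmoothHomogeneous α u) (i : Fin n) :
    SmoothHomogeneous (α - 1) (partialDeriv i u) where
  contDiffOn := contDiffOn_partialDeriv i hu.contDiffOn
  map_smul t ht x hx := by
    have h1 : HasFDerivAt (fun y => u (t • y))
        ((fderiv ℝ u (t • x)).comp (t • ContinuousLinearMap.id ℝ _)) x :=
      (hu.differentiableAt (smul_ne_zero ht.ne' hx)).hasFDerivAt.comp x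
        ((hasFDerivAt_id x).const_smul t)
    have h2 : (fun y => u (t • y)) =ᶠ[𝓝 x] fun y => t ^ α * u y := by
      filter_upwards [isOpen_compl_singleton.mem_nhds hx] with y hy using hu.map_smul t ht y hy
    have h3 := h1.unique
      (((hu.differentiableAt hx).hasFDerivAt.const_mul (t ^ α)).congr_of_eventuallyEq h2)
    have h4 := DFunLike.congr_fun h3 (EuclideanSpace.single i 1)
    simp only [ContinuousLinearMap.comp_apply, smul_apply, smul_eq_mul,
      ContinuousLinearMap.id_apply, ContinuousLinearMap.map_smul] at h4
    simp only [partialDeriv]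
    rw [Real.rpow_sub_one ht.ne']
    field_simp
    linarith

/-- Euler's identity. -/
lemma sum_mul_partialDeriv (hu : SmoothHomogeneous α u) {x : EuclideanSpace ℝ (Fin n)}
    (hx : x ≠ 0) : ∑ i, x i * partialDeriv i u x = α * u x := by
  rw [← fderiv_eq_sum_partialDeriv]
  have h0 : HasFDerivAt u (fderiv ℝ u x) ((1 : ℝ) • x) := by
    simpa using (hu.differentiableAt hx).hasFDerivAt
  have h1 : HasDerivAt (fun t : ℝ => u (t • x)) (fderiv ℝ u x ((1 : ℝ) • x)) 1 :=
    h0.comp_hasDerivAt (1 : ℝ) ((hasDerivAt_id (1 : ℝ)).smul_const x)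
  have h2 : HasDerivAt (fun t : ℝ => t ^ α * u x) (α * 1 ^ (α - 1) * u x) 1 :=
    (Real.hasDerivAt_rpow_const (Or.inl one_ne_zero)).mul_const _
  have h3 : (fun t : ℝ => u (t • x)) =ᶠ[𝓝 1] fun t => t ^ α * u x := by
    filter_upwards [lt_mem_nhds one_pos] with t ht using hu.map_smul t ht x hx
  simpa using h1.unique (h2.congr_of_eventuallyEq h3)

lemma eq_zero_of_partialDeriv_eq_zero (hu : SmoothHomogeneous α u) (hα : α ≠ 0)
    {x : EuclideanSpace ℝ (Fin n)} (hx : x ≠ 0) (h : ∀ i, partialDeriv i u x = 0) :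
    u x = 0 := by
  have := hu.sum_mul_partialDeriv hx
  simp only [h, mul_zero, Finset.sum_const_zero] at this
  exact (mul_eq_zero.1 this.symm).resolve_left hα

lemma partialDeriv_comm (hu : SmoothHomogeneous α u) (i j : Fin n)
    {x : EuclideanSpace ℝ (Fin n)} (hx : x ≠ 0) :
    partialDeriv i (partialDeriv j u) x
      = partialDeriv j (partialDeriv i u) x := by
  have hsymm : IsSymmSndFDerivAt ℝ u x :=
    (hu.contDiffAt hx).isSymmSndFDerivAt
      (by simpa using WithTop.coe_le_coe.2 (le_top : (2 : ℕ∞) ≤ ⊤))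
  have hd : DifferentiableAt ℝ (fderiv ℝ u) x :=
    ((hu.contDiffAt hx).fderiv_right (m := (⊤ : ℕ∞)) (by simp)).differentiableAt (by simp)
  have key : ∀ a b : Fin n, partialDeriv a (partialDeriv b u) x
      = fderiv ℝ (fderiv ℝ u) x (EuclideanSpace.single a 1) (EuclideanSpace.single b 1) := by
    intro a b
    change fderiv ℝ (fun y => fderiv ℝ u y (EuclideanSpace.single b 1)) x _ = _
    simp [fderiv_clm_apply hd (differentiableAt_const _)]
  rw [key, key]
  exact hsymm _ _

protected lemma lap (hu : SmoothHomogeneous α u) : SmoothHomogeneous (α - 2) (lap u) where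
  contDiffOn := by
    change ContDiffOn ℝ _ (fun x => -∑ i, partialDeriv i (partialDeriv i u) x) _
    exact (ContDiffOn.sum fun i _ =>
      contDiffOn_partialDeriv i (contDiffOn_partialDeriv i hu.contDiffOn)).neg
  map_smul t ht x hx := by
    simp only [lap_eq_neg_sum_partialDeriv]
    rw [mul_neg, Finset.mul_sum]
    congr 1
    refine Finset.sum_congr rfl fun i _ => ?_
    rw [((hu.partialDeriv i).partialDeriv i).map_smul t ht x hx]
    congr 2
    ring

lemma lap_partialDeriv_eq_zero (hu : SmoothHomogeneous α u) (h : ∀ x, x ≠ 0 → lap u x = 0)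
    (j : Fin n) {x : EuclideanSpace ℝ (Fin n)} (hx : x ≠ 0) :
    lap (partialDeriv j u) x = 0 := by
  have h1 : partialDeriv j (lap u) x = 0 := by
    rw [partialDeriv_congr j (g := fun _ => 0) h x hx]
    simp [partialDeriv]
  have h2 : partialDeriv j (lap u) x
      = -∑ i, partialDeriv j (partialDeriv i (partialDeriv i u)) x := by
    have hd := HasFDerivAt.fun_sum (u := Finset.univ) fun i _ =>
      (((hu.partialDeriv i).partialDeriv i).differentiableAt hx).hasFDerivAt
    change fderiv ℝ (fun y => -∑ i, partialDeriv i (partialDeriv i u) y) x _ = _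
    rw [hd.fun_neg.fderiv]
    simp [partialDeriv]
  rw [lap_eq_neg_sum_partialDeriv, ← h1, h2]
  congr 1
  refine Finset.sum_congr rfl fun i _ => ?_
  rw [(hu.partialDeriv i).partialDeriv_comm j i hx]
  exact partialDeriv_congr i (fun y hy => hu.partialDeriv_comm i j hy) x hx

lemma norm_rpow_mul (hu : SmoothHomogeneous α u) (s : ℝ) :
    SmoothHomogeneous (s + α) (fun x => ‖x‖ ^ s * u x) where
  contDiffOn := (contDiffOn_norm_rpow s).mul hu.contDiffOn
  map_smul t ht x hx := by
    rw [hu.map_smul t ht x hx, norm_smul, Real.norm_of_nonneg ht.le,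
      Real.mul_rpow ht.le (norm_nonneg x), Real.rpow_add ht]
    ring

lemma lap_norm_rpow_mul (hu : SmoothHomogeneous α u) (s : ℝ) {x : EuclideanSpace ℝ (Fin n)}
    (hx : x ≠ 0) :
    lap (fun y => ‖y‖ ^ s * u y) x
      = -(s * (s + n - 2 + 2 * α)) * ‖x‖ ^ (s - 2) * u x + ‖x‖ ^ s * lap u x := by
  have hN : ∀ (r : ℝ) {y : EuclideanSpace ℝ (Fin n)}, y ≠ 0 →
      DifferentiableAt ℝ (fun z : EuclideanSpace ℝ (Fin n) => ‖z‖ ^ r) y := fun r y hy =>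
    ((contDiffOn_norm_rpow r).contDiffAt (isOpen_compl_singleton.mem_nhds hy)).differentiableAt
      (by simp)
  have hc : ∀ i : Fin n, DifferentiableAt ℝ (fun z : EuclideanSpace ℝ (Fin n) => z i) x :=
    fun i => (EuclideanSpace.proj i : EuclideanSpace ℝ (Fin n) →L[ℝ] ℝ).differentiableAt
  have hfirst : ∀ i : Fin n, ∀ y : EuclideanSpace ℝ (Fin n), y ≠ 0 →
      partialDeriv i (fun y => ‖y‖ ^ s * u y) y
        = s * (y i * (‖y‖ ^ (s - 2) * u y)) + ‖y‖ ^ s * partialDeriv i u y := by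
    intro i y hy
    rw [partialDeriv_mul i (hN s hy) (hu.differentiableAt hy), partialDeriv_norm_rpow i s y hy]
    ring
  have hconst : ∀ i : Fin n, partialDeriv i (fun _ => s) x = 0 := fun i => by
    simp [partialDeriv]
  have hsecond : ∀ i : Fin n,
      partialDeriv i (partialDeriv i (fun y => ‖y‖ ^ s * u y)) x
        = s * ‖x‖ ^ (s - 2) * u x + s * (s - 2) * ‖x‖ ^ (s - 2 - 2) * u x * x i ^ 2
          + 2 * s * ‖x‖ ^ (s - 2) * (x i * partialDeriv i u x)
          + ‖x‖ ^ s * partialDeriv i (partialDeriv i u) x := by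
    intro i
    have hNu : DifferentiableAt ℝ (fun y => ‖y‖ ^ (s - 2) * u y) x :=
      (hN (s - 2) hx).mul (hu.differentiableAt hx)
    have hp := (hu.partialDeriv i).differentiableAt hx
    rw [partialDeriv_congr i (hfirst i) x hx,
      partialDeriv_add i ((differentiableAt_const s).fun_mul ((hc i).fun_mul hNu))
        ((hN s hx).fun_mul hp),
      partialDeriv_mul i (differentiableAt_const s) ((hc i).fun_mul hNu),
      partialDeriv_mul i (hc i) hNu,
      partialDeriv_mul i (hN (s - 2) hx) (hu.differentiableAt hx),
      partialDeriv_mul i (hN s hx) hp,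
      partialDeriv_norm_rpow i s x hx, partialDeriv_norm_rpow i (s - 2) x hx,
      partialDeriv_coord, hconst]
    ring
  have hnorm : ‖x‖ ^ (s - 2 - 2) * ∑ i, x i ^ 2 = ‖x‖ ^ (s - 2) := by
    rw [← EuclideanSpace.real_norm_sq_eq, ← Real.rpow_natCast,
      ← Real.rpow_add (norm_pos_iff.2 hx)]
    congr 1
    push_cast
    ring
  simp only [lap_eq_neg_sum_partialDeriv, hsecond, Finset.sum_add_distrib, ← Finset.mul_sum,
    hu.sum_mul_partialDeriv hx, Finset.sum_const, Finset.card_univ, Fintype.card_fin, nsmul_eq_mul]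
  linear_combination -(s * (s - 2) * u x) * hnorm

end SmoothHomogeneous

/-- The second derivative is nonpositive at a local maximum. -/
lemma IsLocalMax.deriv_deriv_nonpos {f : ℝ → ℝ} {a : ℝ} (h : IsLocalMax f a)
    (hf : ContinuousAt f a) : deriv (deriv f) a ≤ 0 := by
  by_contra! hpos
  have hmin := isLocalMin_of_deriv_deriv_pos hpos h.deriv_eq_zero hf
  have hconst : f =ᶠ[𝓝 a] fun _ => f a := by
    filter_upwards [h, hmin] with x h1 h2 using le_antisymm h1 h2
  have h2 : deriv (deriv f) a = 0 := by
    rw [hconst.deriv.deriv_eq]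
    simp
  exact hpos.ne' h2

namespace SmoothHomogeneous

variable {n : ℕ} {α : ℝ} {u : EuclideanSpace ℝ (Fin n) → ℝ}

lemma lap_nonneg_of_isLocalMax (hu : SmoothHomogeneous α u) {x : EuclideanSpace ℝ (Fin n)}
    (hx : x ≠ 0) (h : IsLocalMax u x) : 0 ≤ lap u x := by
  rw [lap_eq_neg_sum_partialDeriv, neg_nonneg]
  refine Finset.sum_nonpos fun i _ => ?_
  set e : EuclideanSpace ℝ (Fin n) := EuclideanSpace.single i 1
  have hline : ∀ t : ℝ, HasDerivAt (fun t : ℝ => x + t • e) e t := fun t => by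
    simpa using ((hasDerivAt_id t).smul_const e).const_add x
  have hcont : Tendsto (fun t : ℝ => x + t • e) (𝓝 0) (𝓝 x) := by
    simpa using (hline 0).continuousAt.tendsto
  have hcomp : ∀ {f : EuclideanSpace ℝ (Fin n) → ℝ} {t : ℝ},
      DifferentiableAt ℝ f (x + t • e) →
      HasDerivAt (fun t : ℝ => f (x + t • e)) (partialDeriv i f (x + t • e)) t :=
    fun {f t} hf => hf.hasFDerivAt.comp_hasDerivAt t (hline t)
  have hd0 : HasDerivAt (fun t : ℝ => u (x + t • e)) (partialDeriv i u (x + (0 : ℝ) • e)) 0 :=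
    hcomp (by simpa using hu.differentiableAt hx)
  have hmax : IsLocalMax (fun t : ℝ => u (x + t • e)) 0 := by
    filter_upwards [hcont.eventually h] with t ht
    simpa using ht
  have hderiv : deriv (fun t : ℝ => u (x + t • e)) =ᶠ[𝓝 0]
      fun t => partialDeriv i u (x + t • e) := by
    filter_upwards [hcont.eventually (isOpen_compl_singleton.mem_nhds hx)] with t ht
    exact (hcomp (hu.differentiableAt ht)).deriv
  have hd1 := hcomp (t := 0) (f := partialDeriv i u)
    (by simpa using (hu.partialDeriv i).differentiableAt hx)
  have := hmax.deriv_deriv_nonpos hd0.continuousAt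
  rw [hderiv.deriv_eq, hd1.deriv] at this
  simpa using this

lemma eq_norm_rpow_mul (hu : SmoothHomogeneous α u) {x : EuclideanSpace ℝ (Fin n)}
    (hx : x ≠ 0) : u x = ‖x‖ ^ α * u (‖x‖⁻¹ • x) := by
  rw [← hu.map_smul _ (norm_pos_iff.2 hx) _
    (smul_ne_zero (inv_ne_zero (norm_ne_zero_iff.2 hx)) hx), smul_smul,
    mul_inv_cancel₀ (norm_ne_zero_iff.2 hx), one_smul]

lemma norm_rpow_neg_mul_eq (hu : SmoothHomogeneous α u) {x : EuclideanSpace ℝ (Fin n)}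
    (hx : x ≠ 0) : ‖x‖ ^ (-α) * u x = u (‖x‖⁻¹ • x) := by
  have hpos := norm_pos_iff.2 hx
  rw [hu.eq_norm_rpow_mul hx, ← mul_assoc, ← Real.rpow_add hpos]
  simp

/-- A maximum principle in the range of degrees where `α * (α + n - 2) < 0`. -/
lemma nonpos_of_harmonic (hu : SmoothHomogeneous α u) (h : ∀ x, x ≠ 0 → lap u x = 0)
    (hα : α * (α + n - 2) < 0) {x : EuclideanSpace ℝ (Fin n)} (hx : x ≠ 0) : u x ≤ 0 := by
  have hunit : ∀ {y : EuclideanSpace ℝ (Fin n)}, y ≠ 0 →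
      ‖y‖⁻¹ • y ∈ Metric.sphere (0 : EuclideanSpace ℝ (Fin n)) 1 := fun {y} hy => by
    simp [norm_smul, inv_mul_cancel₀ (norm_ne_zero_iff.2 hy)]
  have hsphere : Metric.sphere (0 : EuclideanSpace ℝ (Fin n)) 1 ⊆ {0}ᶜ := by
    rintro y hy rfl
    simp at hy
  obtain ⟨z, hz, hzmax⟩ := (isCompact_sphere (0 : EuclideanSpace ℝ (Fin n)) 1).exists_isMaxOn
    ⟨_, hunit hx⟩ (hu.contDiffOn.continuousOn.mono hsphere)
  have hz0 : z ≠ 0 := hsphere hz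
  have hz1 : ‖z‖ = 1 := by simpa using hz
  have hmax : IsLocalMax (fun y => ‖y‖ ^ (-α) * u y) z := by
    filter_upwards [isOpen_compl_singleton.mem_nhds hz0] with y hy
    rw [hu.norm_rpow_neg_mul_eq hy, hz1, Real.one_rpow, one_mul]
    exact hzmax (hunit hy)
  have hlap := (hu.norm_rpow_mul (-α)).lap_nonneg_of_isLocalMax hz0 hmax
  rw [hu.lap_norm_rpow_mul (-α) hz0, h z hz0, hz1] at hlap
  simp only [Real.one_rpow] at hlap
  have hzle : u z ≤ 0 := by
    by_contra! hpos
    nlinarith [mul_neg_of_neg_of_pos hα hpos]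
  rw [hu.eq_norm_rpow_mul hx]
  exact mul_nonpos_of_nonneg_of_nonpos (by positivity) ((hzmax (hunit hx)).trans hzle)

lemma eq_zero_of_harmonic_of_neg (hu : SmoothHomogeneous α u)
    (h : ∀ x, x ≠ 0 → lap u x = 0) (hα : α * (α + n - 2) < 0)
    {x : EuclideanSpace ℝ (Fin n)} (hx : x ≠ 0) : u x = 0 := by
  refine le_antisymm (hu.nonpos_of_harmonic h hα hx) ?_
  have hneg : ∀ y : EuclideanSpace ℝ (Fin n), y ≠ 0 → lap (fun z => -u z) y = 0 := by
    intro y hy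
    have := h y hy
    simp only [lap, fderiv_fun_neg, neg_apply, Finset.sum_neg_distrib] at this ⊢
    linarith
  simpa using hu.neg.nonpos_of_harmonic hneg hα hx

lemma eq_zero_of_harmonic_of_gt (hn : 3 ≤ n) (m : ℕ) :
    ∀ {α : ℝ} {u : EuclideanSpace ℝ (Fin n) → ℝ}, SmoothHomogeneous α u →
      (∀ x, x ≠ 0 → lap u x = 0) → (∀ j : ℤ, α ≠ j) → 2 - n < α → α < m →
      ∀ x, x ≠ 0 → u x = 0 := by
  have hn' : (3 : ℝ) ≤ n := by exact_mod_cast hn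
  induction m with
  | zero =>
    intro α u hu h _ hlo hhi x hx
    refine hu.eq_zero_of_harmonic_of_neg h ?_ hx
    exact mul_neg_of_neg_of_pos (by simpa using hhi) (by linarith)
  | succ m ih =>
    intro α u hu h hα hlo hhi x hx
    rcases lt_or_ge α m with hm | hm
    · exact ih hu h hα hlo hm x hx
    · have hα0 : α ≠ 0 := by simpa using hα 0
      have hpos : 0 < α := lt_of_le_of_ne (m.cast_nonneg.trans hm) hα0.symm
      refine hu.eq_zero_of_partialDeriv_eq_zero hα0 hx fun i => ?_
      refine ih (hu.partialDeriv i) (fun y hy => hu.lap_partialDeriv_eq_zero h i hy) ?_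
        (by linarith) (by push_cast at hhi; linarith) x hx
      intro j hj
      exact hα (j + 1) (by push_cast; linarith)

/-- In dimension at least three, the degrees below `2 - n` are reached by Kelvin's transform. -/
lemma eq_zero_of_harmonic_of_three_le (hn : 3 ≤ n) (hu : SmoothHomogeneous α u)
    (h : ∀ x, x ≠ 0 → lap u x = 0) (hα : ∀ j : ℤ, α ≠ j)
    {x : EuclideanSpace ℝ (Fin n)} (hx : x ≠ 0) : u x = 0 := by
  have hn' : (3 : ℝ) ≤ n := by exact_mod_cast hn
  rcases lt_trichotomy α (2 - n) with hlt | heq | hgt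
  · have hK := hu.norm_rpow_mul (2 - n - 2 * α)
    obtain ⟨m, hm⟩ := exists_nat_gt (2 - n - 2 * α + α)
    have := eq_zero_of_harmonic_of_gt hn m hK (fun y hy => ?_) (fun j hj => ?_)
      (by linarith) hm x hx
    · exact (mul_eq_zero.1 this).resolve_left
        (Real.rpow_pos_of_pos (norm_pos_iff.2 hx) _).ne'
    · rw [hu.lap_norm_rpow_mul _ hy, h y hy]
      ring
    · exact hα (2 - n - j) (by push_cast; linarith)
  · exact absurd (by push_cast; exact heq) (hα (2 - n))
  · obtain ⟨m, hm⟩ := exists_nat_gt α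
    exact eq_zero_of_harmonic_of_gt hn m hu h hα hgt hm x hx

end SmoothHomogeneous

/-- A `2π`-periodic solution of `z' = -iβz` with `β` not an integer vanishes. -/
lemma eq_zero_of_hasDerivAt_of_periodic {β : ℝ} (hβ : ∀ j : ℤ, β ≠ j) {z : ℝ → ℂ}
    (hz : ∀ θ, HasDerivAt z (-(Complex.I * β) * z θ) θ) (hper : z (2 * π) = z 0) (θ : ℝ) :
    z θ = 0 := by
  have hexp : ∀ θ : ℝ, HasDerivAt (fun t : ℝ => Complex.exp (Complex.I * β * t))
      (Complex.exp (Complex.I * β * θ) * (Complex.I * β)) θ := fun θ => by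
    simpa using ((Complex.ofRealCLM.hasDerivAt (x := θ)).const_mul (Complex.I * β)).cexp
  have hconst : ∀ s t : ℝ, z s * Complex.exp (Complex.I * β * s)
      = z t * Complex.exp (Complex.I * β * t) := by
    refine is_const_of_deriv_eq_zero
      (f := fun t : ℝ => z t * Complex.exp (Complex.I * β * t))
      (fun t => ((hz t).mul (hexp t)).differentiableAt) fun t => ?_
    rw [((hz t).fun_mul (hexp t)).deriv]
    ring
  have hne : Complex.exp (Complex.I * β * (2 * π : ℝ)) ≠ 1 := by
    intro h
    obtain ⟨j, hj⟩ := Complex.exp_eq_one_iff.1 h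
    have h2 : (2 * π * Complex.I : ℂ) ≠ 0 := Complex.two_pi_I_ne_zero
    refine hβ j ?_
    have : (β : ℂ) = j := by
      apply mul_right_cancel₀ h2
      rw [← hj]
      push_cast
      ring
    exact_mod_cast this
  have h0 : z 0 = 0 := by
    have := hconst (2 * π) 0
    rw [hper] at this
    by_contra hz0
    apply hne
    simpa using mul_left_cancel₀ hz0 this
  have := hconst θ 0
  rw [h0, zero_mul] at this
  exact (mul_eq_zero.1 this).resolve_right (Complex.exp_ne_zero _)

namespace SmoothHomogeneous

/-- On the plane, the gradient restricted to the unit circle solves a rotation equation. -/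
lemma eq_zero_of_harmonic_of_two {α : ℝ} {u : EuclideanSpace ℝ (Fin 2) → ℝ}
    (hu : SmoothHomogeneous α u) (h : ∀ x, x ≠ 0 → lap u x = 0) (hα : ∀ j : ℤ, α ≠ j)
    {x : EuclideanSpace ℝ (Fin 2)} (hx : x ≠ 0) : u x = 0 := by
  set γ : ℝ → EuclideanSpace ℝ (Fin 2) := fun θ => !₂[Real.cos θ, Real.sin θ] with hγ
  have hγ0 : ∀ θ, γ θ ≠ 0 := fun θ h0 => by
    have hc : Real.cos θ = 0 := by simpa [hγ] using congrArg (fun v => v 0) h0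
    have hs : Real.sin θ = 0 := by simpa [hγ] using congrArg (fun v => v 1) h0
    have := Real.sin_sq_add_cos_sq θ
    simp [hc, hs] at this
  have hγd : ∀ θ, HasDerivAt γ !₂[-Real.sin θ, Real.cos θ] θ := fun θ => by
    have hpi : HasDerivAt (fun t => ![Real.cos t, Real.sin t]) ![-Real.sin θ, Real.cos θ] θ := by
      rw [hasDerivAt_pi]
      intro i
      fin_cases i
      · simpa using Real.hasDerivAt_cos θ
      · simpa using Real.hasDerivAt_sin θ
    exact (PiLp.continuousLinearEquiv 2 ℝ
      (fun _ : Fin 2 => ℝ)).symm.hasFDerivAt.comp_hasDerivAt θ hpi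
  have hcomp : ∀ (i : Fin 2) (θ : ℝ), HasDerivAt (fun t => partialDeriv i u (γ t))
      (-Real.sin θ * partialDeriv 0 (partialDeriv i u) (γ θ)
        + Real.cos θ * partialDeriv 1 (partialDeriv i u) (γ θ)) θ := fun i θ => by
    have := ((hu.partialDeriv i).differentiableAt (hγ0 θ)).hasFDerivAt.comp_hasDerivAt θ (hγd θ)
    rw [fderiv_eq_sum_partialDeriv] at this
    simpa [Fin.sum_univ_two, Function.comp_def] using this
  have heuler : ∀ (i : Fin 2) (θ : ℝ),
      Real.cos θ * partialDeriv 0 (partialDeriv i u) (γ θ)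
        + Real.sin θ * partialDeriv 1 (partialDeriv i u) (γ θ)
        = (α - 1) * partialDeriv i u (γ θ) := fun i θ => by
    simpa [Fin.sum_univ_two, hγ] using (hu.partialDeriv i).sum_mul_partialDeriv (hγ0 θ)
  have hlap : ∀ θ, partialDeriv 0 (partialDeriv 0 u) (γ θ)
      + partialDeriv 1 (partialDeriv 1 u) (γ θ) = 0 := fun θ => by
    have := h _ (hγ0 θ)
    rw [lap_eq_neg_sum_partialDeriv, neg_eq_zero] at this
    simpa [Fin.sum_univ_two] using this
  have hz : ∀ θ, ((partialDeriv 0 u (γ θ) : ℂ)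
      + (partialDeriv 1 u (γ θ) : ℂ) * Complex.I) = 0 := by
    refine eq_zero_of_hasDerivAt_of_periodic (β := α - 1) (fun j hj => ?_) (fun θ => ?_) ?_
    · exact hα (j + 1) (by push_cast; linarith)
    · have hcomm := hu.partialDeriv_comm 0 1 (hγ0 θ)
      have h0 := (hcomp 0 θ).ofReal_comp
      have h1 := (hcomp 1 θ).ofReal_comp.mul_const Complex.I
      refine (h0.fun_add h1).congr_deriv ?_
      have e0 : -Real.sin θ * partialDeriv 0 (partialDeriv 0 u) (γ θ)
          + Real.cos θ * partialDeriv 1 (partialDeriv 0 u) (γ θ)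
          = (α - 1) * partialDeriv 1 u (γ θ) := by
        rw [← heuler 1 θ, hcomm]
        linear_combination -Real.sin θ * hlap θ
      have e1 : -Real.sin θ * partialDeriv 0 (partialDeriv 1 u) (γ θ)
          + Real.cos θ * partialDeriv 1 (partialDeriv 1 u) (γ θ)
          = -((α - 1) * partialDeriv 0 u (γ θ)) := by
        rw [← heuler 0 θ, hcomm]
        linear_combination Real.cos θ * hlap θ
      rw [e0, e1]
      push_cast
      linear_combination ((α : ℂ) - 1) * partialDeriv 1 u (γ θ) * Complex.I_sq
    · simp [hγ]
  have hcircle : ∀ θ, u (γ θ) = 0 := fun θ => by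
    refine hu.eq_zero_of_partialDeriv_eq_zero (by simpa using hα 0) (hγ0 θ) fun i => ?_
    have hre := congrArg Complex.re (hz θ)
    have him := congrArg Complex.im (hz θ)
    fin_cases i
    · simpa using hre
    · simpa using him
  have hpolar : γ (Complex.arg ⟨x 0, x 1⟩) = ‖x‖⁻¹ • x := by
    have hne : (⟨x 0, x 1⟩ : ℂ) ≠ 0 := fun h0 => hx <| by
      ext i
      fin_cases i
      · simpa using congrArg Complex.re h0
      · simpa using congrArg Complex.im h0
    have hnorm : ‖(⟨x 0, x 1⟩ : ℂ)‖ = ‖x‖ := by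
      rw [Complex.norm_eq_sqrt_sq_add_sq, EuclideanSpace.norm_eq]
      simp [Fin.sum_univ_two]
    ext i
    fin_cases i
    · simp [hγ, Complex.cos_arg hne, hnorm, div_eq_inv_mul]
    · simp [hγ, Complex.sin_arg, hnorm, div_eq_inv_mul]
  rw [hu.eq_norm_rpow_mul hx, ← hpolar, hcircle, mul_zero]

lemma eq_zero_of_harmonic {n : ℕ} {α : ℝ} {u : EuclideanSpace ℝ (Fin n) → ℝ} (hn : 2 ≤ n)
    (hu : SmoothHomogeneous α u) (h : ∀ x, x ≠ 0 → lap u x = 0) (hα : ∀ j : ℤ, α ≠ j)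
    {x : EuclideanSpace ℝ (Fin n)} (hx : x ≠ 0) : u x = 0 := by
  rcases hn.eq_or_lt with rfl | hn
  · exact hu.eq_zero_of_harmonic_of_two h hα hx
  · exact hu.eq_zero_of_harmonic_of_three_le hn h hα hx

lemma eq_zero_of_polyharmonic {n : ℕ} (hn : 2 ≤ n) (k : ℕ) :
    ∀ {α : ℝ} {u : EuclideanSpace ℝ (Fin n) → ℝ}, SmoothHomogeneous α u →
      (∀ x, x ≠ 0 → lapIter k u x = 0) → (∀ j : ℤ, α ≠ j) → ∀ x, x ≠ 0 → u x = 0 := by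
  induction k with
  | zero => exact fun _ h _ => h
  | succ k ih =>
    intro α u hu h hα x hx
    refine hu.eq_zero_of_harmonic hn (ih hu.lap h fun j hj => ?_) hα hx
    exact hα (j + 2) (by push_cast; linarith)

end SmoothHomogeneous

theorem homogeneous_polyharmonic_of_nonintegral_degree_is_zero
    (n k : ℕ) (hn : 2 ≤ n) (hk : 1 ≤ k) (α : ℝ) (hα : ∀ m : ℤ, α ≠ (m : ℝ))
    (u : EuclideanSpace ℝ (Fin n) → ℝ)
    (hsmooth : ContDiffOn ℝ (⊤ : ℕ∞) u {(0 : EuclideanSpace ℝ (Fin n))}ᶜ)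
    (hhom : ∀ t : ℝ, 0 < t → ∀ x : EuclideanSpace ℝ (Fin n), x ≠ 0 →
      u (t • x) = t ^ α * u x)
    (hharm : ∀ x : EuclideanSpace ℝ (Fin n), x ≠ 0 → lapIter k u x = 0) :
    ∀ x : EuclideanSpace ℝ (Fin n), x ≠ 0 → u x = 0 :=
  SmoothHomogeneous.eq_zero_of_polyharmonic hn k ⟨hsmooth, hhom⟩ hharm hα
end
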